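/- Let β > 0 and let n ≥ 0 be an integer. Let (α_N) be a sequence of positive reals with α_N → 0 and α_N·N/√(ln N) → ∞ as N → ∞. Set N_β = N + βN(N−1)/2, C_{Nβ} = Γ(N_β/2)·2^{N_β/2−1}·β^{−N_β/2}, and I_N = (1/C_{Nβ}) ∫_0^{(N/√2)(1−α_N)} e^{−βu²/2} u^{N_β−n−1} du. Then limsup_{N→∞} (log I_N)/((N·α_N)²) ≤ −β/2; that is, I_N = O(e^{−0.5β(Nα_N)²(1+o(1))}). -/

import Mathlib

open MeasureTheory Filter Real Topology

noncomputable section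

/-- The β-Vandermonde factor `∏_{j<k} |x_j - x_k|^β`. -/
def vand (β : ℝ) (N : ℕ) (x : Fin N → ℝ) : ℝ :=
  ∏ p ∈ Finset.univ.filter (fun p : Fin N × Fin N => p.1 < p.2), |x p.1 - x p.2| ^ β

/-- `N_β = N + βN(N-1)/2`. -/
def Nbeta (β : ℝ) (N : ℕ) : ℝ := N + β * N * (N - 1) / 2

/-- Surface (Hausdorff) measure on the sphere of radius `r` in Euclidean `ℝ^N`. -/
def sphereMeasure (N : ℕ) (r : ℝ) : Measure (EuclideanSpace ℝ (Fin N)) :=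
  (μH[(N : ℝ) - 1]).restrict (Metric.sphere (0 : EuclideanSpace ℝ (Fin N)) r)

/-- Normalization of the fixed trace ensemble: total `Δ_β`-mass of the sphere of radius `r`. -/
def Zft (β : ℝ) (N : ℕ) (r : ℝ) : ℝ :=
  ∫ x, vand β N x ∂(sphereMeasure N r)

/-- Glue `(x_1,…,x_n)` and `(x_{n+1},…,x_N)` into a vector in `ℝ^N`. -/
def combine (N n : ℕ) (x : Fin n → ℝ) (y : Fin (N - n) → ℝ) : Fin N → ℝ := fun i =>
  if h : (i : ℕ) < n then x ⟨i, h⟩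
  else y ⟨(i : ℕ) - n, by have := i.isLt; omega⟩

/-- `n`-point correlation function of the fixed trace Gaussian β-ensemble of strength `r`. -/
def Rft (β : ℝ) (n N : ℕ) (r : ℝ) (x : Fin n → ℝ) : ℝ :=
  ((N.factorial : ℝ) / ((N - n).factorial : ℝ)) * (Zft β N r)⁻¹ *
    ∫ y, vand β N (combine N n x y)
      ∂(sphereMeasure (N - n) (Real.sqrt (r ^ 2 - ∑ i, x i ^ 2)))

/-- Normalization of the bounded trace ensemble. -/
def Zbt (β : ℝ) (N : ℕ) (r : ℝ) : ℝ :=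
  ∫ x : Fin N → ℝ, Set.indicator {z : Fin N → ℝ | ∑ i, z i ^ 2 ≤ r ^ 2} (vand β N) x

/-- `n`-point correlation function of the bounded trace Gaussian β-ensemble of strength `r`. -/
def Rbt (β : ℝ) (n N : ℕ) (r : ℝ) (x : Fin n → ℝ) : ℝ :=
  ((N.factorial : ℝ) / ((N - n).factorial : ℝ)) * (Zbt β N r)⁻¹ *
    ∫ y : Fin (N - n) → ℝ,
      Set.indicator {z : Fin N → ℝ | ∑ i, z i ^ 2 ≤ r ^ 2} (vand β N) (combine N n x y)

/-- Normalization of the (unconstrained) Gaussian β-ensemble. -/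
def Zg (β : ℝ) (N : ℕ) : ℝ :=
  ∫ x : Fin N → ℝ, vand β N x * ∏ i, Real.exp (-(β * N * x i ^ 2))

/-- `n`-point correlation function of the Gaussian β-ensemble. -/
def Rg (β : ℝ) (n N : ℕ) (x : Fin n → ℝ) : ℝ :=
  ((N.factorial : ℝ) / ((N - n).factorial : ℝ)) * (Zg β N)⁻¹ *
    ∫ y : Fin (N - n) → ℝ,
      vand β N (combine N n x y) * ∏ i, Real.exp (-(β * N * (combine N n x y i) ^ 2))

/-- The sine kernel `sin(π(x-y))/(π(x-y))`, with value `1` on the diagonal. -/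
def Ksine (x y : ℝ) : ℝ :=
  if x = y then 1 else Real.sin (π * (x - y)) / (π * (x - y))

/-- `S(t) = sin(πt)/(πt)` with `S(0) = 1`. -/
def Ssin (t : ℝ) : ℝ := if t = 0 then 1 else Real.sin (π * t) / (π * t)

/-- The 2×2 matrix sine kernel for β = 1. -/
def K1sine (x y : ℝ) : Fin 2 → Fin 2 → ℝ :=
  ![![Ssin (x - y), deriv Ssin (x - y)],
    ![(∫ t in (0:ℝ)..(x - y), Ssin t) - Real.sign (x - y) / 2, Ssin (x - y)]]

/-- The 2×2 matrix sine kernel for β = 4. -/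
def K4sine (x y : ℝ) : Fin 2 → Fin 2 → ℝ :=
  ![![Ssin (2 * (x - y)), deriv (fun z => Ssin (2 * (z - y))) x],
    ![(∫ t in (0:ℝ)..(x - y), Ssin (2 * t)) - Real.sign (2 * (x - y)) / 2,
      Ssin (2 * (x - y))]]

/-- The Airy function `Ai(x) = lim_{T→∞} (1/π) ∫_0^T cos(t³/3 + xt) dt`. -/
def Ai (x : ℝ) : ℝ :=
  limUnder atTop (fun T : ℝ => (1 / π) * ∫ t in (0:ℝ)..T, Real.cos (t ^ 3 / 3 + x * t))

/-- The Airy kernel. -/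
def KAiry (x y : ℝ) : ℝ :=
  if x = y then (deriv Ai x) ^ 2 - x * (Ai x) ^ 2
  else (Ai x * deriv Ai y - deriv Ai x * Ai y) / (x - y)

/-- `C_{Nβ} = Γ(N_β/2)·2^{N_β/2−1}·β^{−N_β/2}`. -/
def Cnb (β : ℝ) (N : ℕ) : ℝ :=
  Real.Gamma (Nbeta β N / 2) * (2 : ℝ) ^ (Nbeta β N / 2 - 1) * β ^ (-(Nbeta β N) / 2)

end

/-- The radial weight `e^{-βu²/2} u^M`. -/
noncomputable def radialWeight (β M u : ℝ) : ℝ := Real.exp (-(β * u ^ 2 / 2)) * u ^ M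

section RadialWeight

variable {β M K p u α d : ℝ}

theorem radialWeight_pos (hu : 0 < u) : 0 < radialWeight β M u := by
  unfold radialWeight; positivity

theorem radialWeight_eq_exp (hu : 0 < u) :
    radialWeight β M u = Real.exp (-(β * u ^ 2 / 2) + M * Real.log u) := by
  rw [radialWeight, Real.rpow_def_of_pos hu, ← Real.exp_add, mul_comm M]

theorem radialWeight_add_natCast (hu : 0 < u) (n : ℕ) :
    radialWeight β (M + n) u = u ^ n * radialWeight β M u := by
  rw [radialWeight, radialWeight, Real.rpow_add hu, Real.rpow_natCast]; ring

theorem continuous_radialWeight (hM : 0 ≤ M) : Continuous (radialWeight β M) := by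
  unfold radialWeight
  exact (by fun_prop : Continuous fun u : ℝ => Real.exp (-(β * u ^ 2 / 2))).mul
    (Real.continuous_rpow_const hM)

theorem integrableOn_radialWeight (hβ : 0 < β) (hM : -1 < M) :
    IntegrableOn (radialWeight β M) (Set.Ioi 0) := by
  refine (integrableOn_rpow_mul_exp_neg_mul_sq (half_pos hβ) hM).congr_fun ?_ measurableSet_Ioi
  intro x _
  simp only [radialWeight]
  rw [mul_comm]; congr 2; ring

theorem integral_radialWeight (hβ : 0 < β) (hM : -1 < M) :
    ∫ u in Set.Ioi 0, radialWeight β M u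
      = Real.Gamma ((M + 1) / 2) * (2 : ℝ) ^ ((M + 1) / 2 - 1) * β ^ (-(M + 1) / 2) := by
  have h := integral_rpow_mul_exp_neg_mul_rpow two_pos hM (half_pos hβ)
  have h' : ∫ u in Set.Ioi 0, radialWeight β M u
      = ∫ x in Set.Ioi (0 : ℝ), x ^ M * Real.exp (-(β / 2) * x ^ (2 : ℝ)) := by
    congr 1; ext x
    rw [radialWeight, mul_comm, Real.rpow_two]; congr 2; ring
  rw [h', h, Real.div_rpow hβ.le zero_le_two, Real.rpow_sub two_pos, Real.rpow_one, neg_div,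
    Real.rpow_neg zero_le_two]
  field_simp

/-- Concavity of the logarithm bounds the weight by a Gaussian centred near `p`. -/
theorem radialWeight_le_tangent (hM : 0 ≤ M) (hp : 0 < p) (hu : 0 < u) :
    radialWeight β M u
      ≤ radialWeight β M p * Real.exp ((M / p - β * p) * (u - p) - β * (u - p) ^ 2 / 2) := by
  rw [radialWeight_eq_exp hu, radialWeight_eq_exp hp, ← Real.exp_add, Real.exp_le_exp]
  have h := Real.log_le_sub_one_of_pos (div_pos hu hp)
  rw [Real.log_div hu.ne' hp.ne'] at h
  have h2 := mul_le_mul_of_nonneg_left h hM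
  have h3 : M * (u / p - 1) = M / p * (u - p) := by field_simp
  nlinarith

/-- Quadratic lower bound of the weight around an approximate maximiser `p`. -/
theorem le_radialWeight_of_abs_sub_le (hβ : 0 < β) (hM : 0 ≤ M) (hK : 0 ≤ K) (hp : 1 ≤ p)
    (hMp : |M - β * p ^ 2| ≤ K * p) (hd : |p - u| ≤ d) (hdp : d ≤ p / 2) :
    radialWeight β M p * Real.exp (-(K * d + (5 / 2 * β + 2 * K) * d ^ 2))
      ≤ radialWeight β M u := by
  have hp0 : 0 < p := by linarith
  obtain ⟨δ, rfl⟩ : ∃ δ, u = p * (1 - δ) := ⟨(p - u) / p, by field_simp; ring⟩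
  have e : p - p * (1 - δ) = p * δ := by ring
  rw [e] at hd
  have hδ : |δ| ≤ 1 / 2 := by
    rw [abs_mul, abs_of_pos hp0] at hd
    nlinarith
  have hδ' := abs_le.1 hδ
  have hu : 0 < p * (1 - δ) := by apply mul_pos hp0; linarith
  have hlog : -δ - 2 * δ ^ 2 ≤ Real.log (1 - δ) := by
    have h := Real.abs_log_sub_add_sum_range_le (x := δ) (by linarith) 1
    have h2 : |δ| ^ (1 + 1) / (1 - |δ|) ≤ 2 * δ ^ 2 := by
      rw [div_le_iff₀ (by linarith)]
      norm_num
      nlinarith [sq_nonneg δ]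
    have h3 := (abs_le.1 (h.trans h2)).1
    norm_num at h3
    linarith
  rw [radialWeight_eq_exp hu, radialWeight_eq_exp hp0, ← Real.exp_add, Real.exp_le_exp,
    Real.log_mul hp0.ne' (by linarith)]
  have h1 := mul_le_mul_of_nonneg_left hlog hM
  have h2 : |(M - β * p ^ 2) * δ| ≤ K * d := by
    rw [abs_mul]
    calc |M - β * p ^ 2| * |δ| ≤ K * p * |δ| := by gcongr
      _ = K * |p * δ| := by rw [abs_mul, abs_of_pos hp0]; ring
      _ ≤ K * d := by gcongr
  have h3 := (abs_le.1 h2).2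
  have h4 : M ≤ (β + K) * p ^ 2 := by
    have h := (abs_le.1 hMp).2
    have h' : K * p ≤ K * p ^ 2 := by gcongr; nlinarith
    linarith
  have h5 : (p * δ) ^ 2 ≤ d ^ 2 := sq_le_sq' (by linarith [(abs_le.1 hd).1]) (abs_le.1 hd).2
  have h6 : M * δ ^ 2 ≤ (β + K) * d ^ 2 := by
    calc M * δ ^ 2 ≤ (β + K) * p ^ 2 * δ ^ 2 := by gcongr
      _ = (β + K) * (p * δ) ^ 2 := by ring
      _ ≤ _ := by gcongr
  nlinarith

theorem radialWeight_mul_one_sub_le (hM : 0 ≤ M) (hp : 0 < p) (hα : 0 ≤ α) (hα1 : α < 1)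
    (hMp : |M - β * p ^ 2| ≤ K * p) (hK : 0 ≤ K) :
    radialWeight β M (p * (1 - α))
      ≤ radialWeight β M p * Real.exp (2 * K * (p * α) - β * (p * α) ^ 2) := by
  have hu : 0 < p * (1 - α) := by apply mul_pos hp; linarith
  have hlog : Real.log (1 - α) ≤ -α - α ^ 2 / 2 := by
    have h := sum_le_hasSum (Finset.range 2) (fun i _ => by positivity)
      (Real.hasSum_pow_div_log_of_abs_lt_one (x := α) (by rwa [abs_of_nonneg hα]))
    norm_num [Finset.sum_range_succ] at h
    linarith
  rw [radialWeight_eq_exp hu, radialWeight_eq_exp hp, ← Real.exp_add, Real.exp_le_exp,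
    Real.log_mul hp.ne' (by linarith)]
  have h1 := mul_le_mul_of_nonneg_left hlog hM
  have h2 := mul_le_mul_of_nonneg_right (abs_le.1 hMp).1 (by positivity : 0 ≤ α + α ^ 2 / 2)
  have h3 : K * p * (α + α ^ 2 / 2) ≤ K * p * (2 * α) := by gcongr; nlinarith
  nlinarith

theorem integral_radialWeight_le (hM : 0 ≤ M) (hβ : 0 < β) (hu : 0 < u)
    (hMu : β * u ^ 2 ≤ M) :
    ∫ v in (0 : ℝ)..u, radialWeight β M v ≤ u * radialWeight β M u := by
  have h := intervalIntegral.norm_integral_le_of_norm_le_const (a := 0) (b := u)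
    (f := radialWeight β M) (C := radialWeight β M u) ?_
  · rw [sub_zero, abs_of_pos hu, mul_comm] at h
    exact (le_abs_self _).trans h
  intro v hv
  rw [Set.uIoc_of_le hu.le] at hv
  rw [Real.norm_of_nonneg (radialWeight_pos hv.1).le]
  refine (radialWeight_le_tangent hM hu hv.1).trans
    (mul_le_of_le_one_right (radialWeight_pos hu).le ?_)
  rw [Real.exp_le_one_iff]
  have h1 : 0 ≤ M / u - β * u := by
    rw [sub_nonneg, le_div_iff₀ hu]; linarith
  have h2 := mul_nonneg h1 (sub_nonneg.2 hv.2)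
  nlinarith [mul_nonneg hβ.le (sq_nonneg (v - u))]

theorem le_integral_of_forall_le {f : ℝ → ℝ} (hf : Continuous f) {a c : ℝ}
    (h : ∀ u ∈ Set.Icc a (a + 1), c ≤ f u) : c ≤ ∫ u in a..(a + 1), f u := by
  have := intervalIntegral.integral_mono_on (μ := volume) (f := fun _ => c) (g := f)
    (by linarith : a ≤ a + 1) intervalIntegrable_const (hf.intervalIntegrable _ _) h
  simpa using this

theorem le_integral_radialWeight (hβ : 0 < β) (hM : 0 ≤ M) (hK : 0 ≤ K) (hp : 1 ≤ p)
    (hMp : |M - β * p ^ 2| ≤ K * p) (hα : α ≤ 1 / 4) (hpα : 1 ≤ p * α) :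
    radialWeight β M p * Real.exp (-((10 * β + 10 * K) * (p * α) ^ 2))
      ≤ ∫ u in (0 : ℝ)..(p * (1 - α)), radialWeight β M u := by
  have ha : 0 ≤ p * (1 - α) - 1 := by nlinarith
  have h1 := le_integral_of_forall_le (continuous_radialWeight (β := β) hM)
    (a := p * (1 - α) - 1)
    (c := radialWeight β M p * Real.exp (-((10 * β + 10 * K) * (p * α) ^ 2))) ?_
  · rw [sub_add_cancel] at h1
    refine h1.trans (intervalIntegral.integral_mono_interval ha (by linarith) le_rfl ?_
      ((continuous_radialWeight hM).intervalIntegrable _ _))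
    filter_upwards [ae_restrict_mem measurableSet_Ioc] with x hx
    exact (radialWeight_pos hx.1).le
  intro u hu
  rw [sub_add_cancel] at hu
  refine le_trans ?_ (le_radialWeight_of_abs_sub_le hβ hM hK hp hMp (d := 2 * (p * α))
    (abs_le.2 ⟨by nlinarith [hu.2], by nlinarith [hu.1]⟩) (by nlinarith))
  refine mul_le_mul_of_nonneg_left ?_ (radialWeight_pos (by linarith)).le
  rw [Real.exp_le_exp]
  have h : K * (p * α) ≤ K * (p * α) ^ 2 := by gcongr; nlinarith
  linarith

theorem le_integral_Ioi_radialWeight (hβ : 0 < β) (hM : 0 ≤ M) (hK : 0 ≤ K) (hp : 2 ≤ p)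
    (hMp : |M - β * p ^ 2| ≤ K * p) :
    radialWeight β M p * Real.exp (-(5 / 2 * β + 3 * K))
      ≤ ∫ u in Set.Ioi 0, radialWeight β M u := by
  have h1 := le_integral_of_forall_le (continuous_radialWeight (β := β) hM) (a := p)
    (c := radialWeight β M p * Real.exp (-(5 / 2 * β + 3 * K))) ?_
  · rw [intervalIntegral.integral_of_le (by linarith)] at h1
    refine h1.trans (setIntegral_mono_set (integrableOn_radialWeight hβ (by linarith)) ?_ ?_)
    · filter_upwards [ae_restrict_mem measurableSet_Ioi] with x hx
      exact (radialWeight_pos hx).le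
    · exact Filter.Eventually.of_forall fun x hx => lt_trans (by linarith) hx.1
  intro u hu
  refine le_trans (le_of_eq ?_) (le_radialWeight_of_abs_sub_le hβ hM hK (by linarith) hMp (d := 1)
    (abs_le.2 ⟨by linarith [hu.2], by linarith [hu.1]⟩) (by linarith))
  congr 2; ring

theorem integral_Ioi_radialWeight_le (hβ : 0 < β) (hM : 0 ≤ M) (hp : 0 < p)
    (hMp : |M - β * p ^ 2| ≤ K * p) :
    ∫ u in Set.Ioi 0, radialWeight β M u
      ≤ radialWeight β M p * (Real.exp (K ^ 2 / β) * √(π / (β / 4))) := by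
  have hg := ((integrable_exp_neg_mul_sq (by linarith : 0 < β / 4)).comp_sub_right p).const_mul
    (radialWeight β M p * Real.exp (K ^ 2 / β))
  have hc : |M / p - β * p| ≤ K := by
    have : M / p - β * p = (M - β * p ^ 2) / p := by field_simp
    rwa [this, abs_div, abs_of_pos hp, div_le_iff₀ hp]
  calc ∫ u in Set.Ioi 0, radialWeight β M u
      ≤ ∫ u in Set.Ioi 0,
          radialWeight β M p * Real.exp (K ^ 2 / β) * Real.exp (-(β / 4) * (u - p) ^ 2) := by
        refine setIntegral_mono_on (integrableOn_radialWeight hβ (by linarith)) hg.integrableOn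
          measurableSet_Ioi fun u hu => ?_
        refine (radialWeight_le_tangent hM hp hu).trans ?_
        rw [mul_assoc, ← Real.exp_add]
        refine mul_le_mul_of_nonneg_left (Real.exp_le_exp.2 ?_) (radialWeight_pos hp).le
        set c := M / p - β * p
        have h1 : c ^ 2 / β ≤ K ^ 2 / β := by
          gcongr ?_ / _
          exact sq_le_sq' (abs_le.1 hc).1 (abs_le.1 hc).2
        have h2 : 0 ≤ (c - β / 2 * (u - p)) ^ 2 / β := by positivity
        have h3 : (c - β / 2 * (u - p)) ^ 2 / β
            = c ^ 2 / β - c * (u - p) + β / 4 * (u - p) ^ 2 := by field_simp; ring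
        linarith
    _ ≤ ∫ u, radialWeight β M p * Real.exp (K ^ 2 / β) * Real.exp (-(β / 4) * (u - p) ^ 2) := by
        refine setIntegral_le_integral hg (Filter.Eventually.of_forall fun u => ?_)
        have := radialWeight_pos (β := β) (M := M) hp
        simp only [Pi.zero_apply]
        positivity
    _ = _ := by
        rw [integral_const_mul,
          integral_sub_right_eq_self (fun u => Real.exp (-(β / 4) * u ^ 2)) p, integral_gaussian]
        ring

theorem mul_sq_le_of_abs_sub_le (hβ : 0 < β) (hp : 0 < p) (hα : 0 < α) (hα1 : α ≤ 1)
    (hMp : |M - β * p ^ 2| ≤ K * p) (hKα : K ≤ β * (p * α)) :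
    β * (p * (1 - α)) ^ 2 ≤ M := by
  have h1 := (abs_le.1 hMp).1
  have h2 := mul_le_mul_of_nonneg_right hKα hp.le
  have h3 : 0 ≤ β * p ^ 2 * (α * (1 - α)) := by
    have := sub_nonneg.2 hα1
    positivity
  nlinarith

theorem log_radial_le (hβ : 0 < β) (hK : 0 ≤ K) (hp : 2 ≤ p) (hα : 0 < α) (hα1 : α ≤ 1 / 4)
    (n : ℕ) (hMp : |M - β * p ^ 2| ≤ K * p) (hMnp : |M + n - β * p ^ 2| ≤ K * p)
    (hpα : 1 ≤ p * α) (hKα : K ≤ β * (p * α)) :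
    Real.log ((∫ u in Set.Ioi 0, radialWeight β (M + n) u)⁻¹ *
        ∫ u in (0 : ℝ)..(p * (1 - α)), radialWeight β M u)
      ≤ Real.log p + 2 * K * (p * α) + (5 / 2 * β + 3 * K) - β * (p * α) ^ 2 := by
  have hp0 : 0 < p := by linarith
  have hu : 0 < p * (1 - α) := by apply mul_pos hp0; linarith
  have hMu := mul_sq_le_of_abs_sub_le hβ hp0 hα (by linarith) hMp hKα
  have hM : 0 ≤ M := le_trans (by positivity) hMu
  have hw := radialWeight_pos (β := β) (M := M) hp0
  have hJ0 := le_integral_radialWeight hβ hM hK (by linarith) hMp hα1 hpα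
  have hC := le_integral_Ioi_radialWeight hβ (add_nonneg hM n.cast_nonneg) hK hp hMnp
  rw [radialWeight_add_natCast hp0] at hC
  have hC' : radialWeight β M p * Real.exp (-(5 / 2 * β + 3 * K))
      ≤ ∫ u in Set.Ioi 0, radialWeight β (M + n) u := by
    refine le_trans ?_ hC
    gcongr
    exact le_mul_of_one_le_left hw.le (one_le_pow₀ (by linarith))
  have hJ : ∫ u in (0 : ℝ)..(p * (1 - α)), radialWeight β M u
      ≤ p * (radialWeight β M p * Real.exp (2 * K * (p * α) - β * (p * α) ^ 2)) := by
    refine (integral_radialWeight_le hM hβ hu hMu).trans ?_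
    have h := radialWeight_mul_one_sub_le hM hp0 hα.le (by linarith) hMp hK
    exact mul_le_mul (by nlinarith) h (radialWeight_pos hu).le hp0.le
  have hJpos := lt_of_lt_of_le (by positivity) hJ0
  have hCpos := lt_of_lt_of_le (by positivity) hC'
  rw [Real.log_mul (inv_pos.2 hCpos).ne' hJpos.ne', Real.log_inv]
  have h1 := Real.log_le_log (by positivity) hC'
  have h2 := Real.log_le_log hJpos hJ
  rw [Real.log_mul hw.ne' (Real.exp_pos _).ne', Real.log_exp] at h1
  rw [Real.log_mul hp0.ne' (by positivity), Real.log_mul hw.ne' (Real.exp_pos _).ne',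
    Real.log_exp] at h2
  linarith

theorem le_log_radial (hβ : 0 < β) (hK : 0 ≤ K) (hp : 1 ≤ p) (hα : 0 < α) (hα1 : α ≤ 1 / 4)
    (n : ℕ) (hMp : |M - β * p ^ 2| ≤ K * p) (hMnp : |M + n - β * p ^ 2| ≤ K * p)
    (hpα : 1 ≤ p * α) (hKα : K ≤ β * (p * α)) :
    -((10 * β + 10 * K) * (p * α) ^ 2) - n * Real.log p
        - Real.log (Real.exp (K ^ 2 / β) * √(π / (β / 4)))
      ≤ Real.log ((∫ u in Set.Ioi 0, radialWeight β (M + n) u)⁻¹ *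
        ∫ u in (0 : ℝ)..(p * (1 - α)), radialWeight β M u) := by
  have hp0 : 0 < p := by linarith
  have hMu := mul_sq_le_of_abs_sub_le hβ hp0 hα (by linarith) hMp hKα
  have hM : 0 ≤ M := le_trans (by positivity) hMu
  have hw := radialWeight_pos (β := β) (M := M) hp0
  have hJ := le_integral_radialWeight hβ hM hK hp hMp hα1 hpα
  have hC := integral_Ioi_radialWeight_le hβ (add_nonneg hM n.cast_nonneg) hp0 hMnp
  rw [radialWeight_add_natCast hp0] at hC
  have hJpos := lt_of_lt_of_le (by positivity) hJ
  have hCpos : 0 < ∫ u in Set.Ioi 0, radialWeight β (M + n) u := by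
    rw [integral_radialWeight hβ (by linarith [n.cast_nonneg (α := ℝ)])]
    have := Real.Gamma_pos_of_pos (by positivity : 0 < (M + n + 1) / 2)
    positivity
  rw [Real.log_mul (inv_pos.2 hCpos).ne' hJpos.ne', Real.log_inv]
  have h1 := Real.log_le_log hCpos hC
  have h2 := Real.log_le_log (by positivity) hJ
  rw [Real.log_mul (by positivity) (by positivity), Real.log_mul (by positivity) hw.ne',
    Real.log_pow] at h1
  rw [Real.log_mul hw.ne' (Real.exp_pos _).ne', Real.log_exp] at h2
  linarith

end RadialWeight

theorem Cnb_eq_integral {β : ℝ} (hβ : 0 < β) {N : ℕ} (hN : 0 < Nbeta β N) :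
    Cnb β N = ∫ u in Set.Ioi 0, radialWeight β (Nbeta β N - 1) u := by
  rw [integral_radialWeight hβ (by linarith), sub_add_cancel, Cnb]

theorem abs_Nbeta_sub_le {β : ℝ} (hβ : 0 < β) {N m n : ℕ} (hN : 1 ≤ N) (hmn : m ≤ n) :
    |Nbeta β N - m - 1 - β * ((N : ℝ) / √2) ^ 2| ≤ 2 * (2 + β + n) * ((N : ℝ) / √2) := by
  have hN' : (1 : ℝ) ≤ N := by exact_mod_cast hN
  have hmn' : (m : ℝ) ≤ n := by exact_mod_cast hmn
  have hm : (0 : ℝ) ≤ m := m.cast_nonneg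
  have h2 : √2 ≤ 2 := by rw [Real.sqrt_le_left] <;> norm_num
  have h3 : (N : ℝ) ≤ 2 * ((N : ℝ) / √2) := by
    rw [mul_div_assoc', le_div_iff₀ (by positivity)]
    nlinarith
  have h4 : |Nbeta β N - m - 1 - β * ((N : ℝ) / √2) ^ 2| ≤ (2 + β + n) * N := by
    rw [div_pow, Real.sq_sqrt zero_le_two, Nbeta, abs_le]
    have := mul_le_mul hmn' hN' zero_le_one (hm.trans hmn')
    constructor <;> nlinarith [mul_nonneg hβ.le (zero_le_one.trans hN')]
  calc _ ≤ (2 + β + n) * N := h4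
    _ ≤ (2 + β + n) * (2 * ((N : ℝ) / √2)) := by gcongr
    _ = _ := by ring


/-- Lemma 1, first estimate: the lower tail of the radial integral is
`O(e^{-0.5β(Nα_N)²(1+o(1))})`. -/
theorem radial_lower_tail_estimate (β : ℝ) (hβ : 0 < β) (n : ℕ)
    (α : ℕ → ℝ) (hpos : ∀ N, 0 < α N)
    (h0 : Filter.Tendsto α atTop (𝓝 0))
    (hinf : Filter.Tendsto (fun N : ℕ => α N * N / Real.sqrt (Real.log N)) atTop atTop) :
    Filter.limsup
      (fun N : ℕ =>
        Real.log ((Cnb β N)⁻¹ *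
            ∫ u in (0:ℝ)..(((N : ℝ) / Real.sqrt 2) * (1 - α N)),
              Real.exp (-(β * u ^ 2 / 2)) * u ^ (Nbeta β N - n - 1)) /
          ((N * α N) ^ 2)) atTop ≤ -(β / 2) := by
  set K : ℝ := 2 * (2 + β + n)
  have hK : 0 ≤ K := by positivity
  set B : ℝ := Real.log (Real.exp (K ^ 2 / β) * √(π / (β / 4))) with hB
  have hs : 0 < √(2 : ℝ) := by positivity
  have hcast : Tendsto (fun N : ℕ => (N : ℝ)) atTop atTop := tendsto_natCast_atTop_atTop
  have hlog : Tendsto (fun N : ℕ => Real.log N) atTop atTop := Real.tendsto_log_atTop.comp hcast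
  have ha : Tendsto (fun N : ℕ => N * α N) atTop atTop := by
    refine (hinf.atTop_mul_atTop₀ (Real.tendsto_sqrt_atTop.comp hlog)).congr' ?_
    filter_upwards [hlog.eventually_gt_atTop 0] with N hN
    have := Real.sqrt_pos.2 hN
    simp only [Function.comp_apply]
    field_simp
  have hla : Tendsto (fun N : ℕ => Real.log N / (N * α N) ^ 2) atTop (𝓝 0) := by
    refine ((tendsto_pow_atTop two_ne_zero).comp hinf).inv_tendsto_atTop.congr' ?_
    filter_upwards [hlog.eventually_gt_atTop 0] with N hN
    simp only [Pi.inv_apply, Function.comp_apply]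
    rw [div_pow, Real.sq_sqrt hN.le, inv_div, mul_comm (α N)]
  have hinv : Tendsto (fun N : ℕ => (N * α N)⁻¹) atTop (𝓝 0) := ha.inv_tendsto_atTop
  have hgood : ∀ᶠ N : ℕ in atTop, 1 ≤ N ∧ 2 ≤ (N : ℝ) / √2 ∧ α N ≤ 1 / 4 ∧
      1 ≤ (N : ℝ) / √2 * α N ∧ K ≤ β * ((N : ℝ) / √2 * α N) := by
    have hp := hcast.atTop_div_const hs
    have hy := ha.atTop_div_const hs
    filter_upwards [eventually_ge_atTop 1, hp.eventually_ge_atTop 2,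
      h0.eventually_le_const (by norm_num : (0 : ℝ) < 1 / 4), hy.eventually_ge_atTop 1,
      hy.eventually_ge_atTop (K / β)] with N h1 h2 h3 h4 h5
    rw [div_le_iff₀' hβ] at h5
    rw [div_mul_eq_mul_div]
    exact ⟨h1, h2, h3, h4, h5⟩
  have hy2 (N : ℕ) : ((N : ℝ) / √2 * α N) ^ 2 = (N * α N) ^ 2 / 2 := by
    rw [div_mul_eq_mul_div, div_pow, Real.sq_sqrt zero_le_two]
  have hone : (1 : ℝ) ≤ √2 := Real.one_le_sqrt.2 one_le_two
  have hlogle {N : ℕ} (hN : 1 ≤ N) : Real.log ((N : ℝ) / √2) ≤ Real.log N := by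
    have : (0 : ℝ) < N := by exact_mod_cast hN
    exact Real.log_le_log (by positivity) (div_le_self this.le hone)
  have hint {N : ℕ} (hN : 1 ≤ N) : (Cnb β N)⁻¹ *
      ∫ u in (0:ℝ)..(((N : ℝ) / √2) * (1 - α N)),
        Real.exp (-(β * u ^ 2 / 2)) * u ^ (Nbeta β N - n - 1)
      = (∫ u in Set.Ioi 0, radialWeight β (Nbeta β N - n - 1 + n) u)⁻¹ *
        ∫ u in (0 : ℝ)..((N : ℝ) / √2 * (1 - α N)), radialWeight β (Nbeta β N - n - 1) u := by
    have hN' : (1 : ℝ) ≤ N := by exact_mod_cast hN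
    have hpos : 0 < Nbeta β N := by
      rw [Nbeta]
      have := sub_nonneg.2 hN'
      positivity
    rw [Cnb_eq_integral hβ hpos, show Nbeta β N - n - 1 + n = Nbeta β N - 1 by ring]
    rfl
  have hM0 {N : ℕ} (hN : 1 ≤ N) :
      |Nbeta β N - n - 1 + n - β * ((N : ℝ) / √2) ^ 2| ≤ K * ((N : ℝ) / √2) := by
    have h := abs_Nbeta_sub_le hβ hN (Nat.zero_le n)
    rw [Nat.cast_zero] at h
    convert h using 2; ring
  have hv : Tendsto (fun N : ℕ => Real.log N / (N * α N) ^ 2 + 2 * K * (N * α N)⁻¹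
      + (5 / 2 * β + 3 * K) * (N * α N)⁻¹ ^ 2 - β / 2) atTop (𝓝 (-(β / 2))) := by
    have := ((hla.add (hinv.const_mul (2 * K))).add
      ((hinv.pow 2).const_mul (5 / 2 * β + 3 * K))).sub_const (β / 2)
    simpa using this
  rw [← hv.limsup_eq]
  refine limsup_le_limsup ?_ ?_ hv.isBoundedUnder_le
  · filter_upwards [hgood] with N ⟨hN, h2, h3, h4, h5⟩
    have hapos : 0 < N * α N := mul_pos (by exact_mod_cast hN) (hpos N)
    have h := log_radial_le hβ hK h2 (hpos N) h3 n (abs_Nbeta_sub_le hβ hN le_rfl) (hM0 hN) h4 h5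
    rw [← hint hN, hy2] at h
    rw [div_le_iff₀ (by positivity)]
    have hya : (N : ℝ) / √2 * α N ≤ N * α N :=
      mul_le_mul_of_nonneg_right (div_le_self N.cast_nonneg hone) (hpos N).le
    have hKy := mul_le_mul_of_nonneg_left hya (by positivity : 0 ≤ 2 * K)
    refine h.trans ?_
    generalize N * α N = a at *
    have e : (Real.log N / a ^ 2 + 2 * K * a⁻¹ + (5 / 2 * β + 3 * K) * a⁻¹ ^ 2 - β / 2) * a ^ 2
        = Real.log N + 2 * K * a + (5 / 2 * β + 3 * K) - β * (a ^ 2 / 2) := by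
      field_simp
    rw [e]
    linarith [hlogle hN]
  · refine isCoboundedUnder_le_of_eventually_le (x := -(5 * β + 5 * K) - n - |B|) _ ?_
    filter_upwards [hgood, hla.eventually_le_const one_pos, ha.eventually_ge_atTop 1]
      with N ⟨hN, h2, h3, h4, h5⟩ hl ha1
    have h := le_log_radial hβ hK (by linarith) (hpos N) h3 n (abs_Nbeta_sub_le hβ hN le_rfl)
      (hM0 hN) h4 h5
    rw [← hint hN, hy2, ← hB] at h
    have hasq : 1 ≤ (N * α N) ^ 2 := one_le_pow₀ ha1
    rw [le_div_iff₀ (by linarith)]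
    rw [div_le_one (by linarith)] at hl
    refine le_trans ?_ h
    have h6 := mul_le_mul_of_nonneg_left ((hlogle hN).trans hl) (n.cast_nonneg (α := ℝ))
    have h7 := mul_le_mul_of_nonneg_left hasq (abs_nonneg B)
    linarith [le_abs_self B]
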